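/- Let R be a commutative ring, let n ≥ 1 and k ≥ 1 be integers, and let λ₁,…,λ_n, z₁,…,z_n ∈ R satisfy λ₁ + ⋯ + λ_n = 0 (with the convention z⁰ = 1). Then ∑_{r=0}^{2k} (−1)^{r+1}·binom(2k, r)·(∑_{i=1}^n λ_i·z_i^r)·(∑_{j=1}^n λ_j·z_j^{2k−r}) = −2·∑_{1≤i<j≤n} λ_i·λ_j·(z_i − z_j)^{2k}. -/

import Mathlib

/-- A double sum of a symmetric function vanishing on the diagonal is twice its sum over `i < j`. -/
theorem sum_sum_eq_two_mul_sum_lt {R ι : Type*} [NonAssocSemiring R] [Fintype ι] [LinearOrder ι]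
    (f : ι → ι → R) (hsymm : ∀ i j, f i j = f j i) (hdiag : ∀ i, f i i = 0) :
    ∑ i, ∑ j, f i j = 2 * ∑ i, ∑ j ∈ Finset.univ.filter (fun j => i < j), f i j := by
  have hsplit : ∀ i j, f i j = (if i < j then f i j else 0) + (if j < i then f j i else 0) := by
    intro i j
    rcases lt_trichotomy i j with h | rfl | h
    · simp [h, h.not_gt]
    · simp [hdiag]
    · simp [h, h.not_gt, hsymm i j]
  simp_rw [Finset.sum_filter]
  rw [Finset.sum_congr rfl fun i _ => Finset.sum_congr rfl fun j _ => hsplit i j]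
  simp_rw [Finset.sum_add_distrib]
  rw [Finset.sum_comm (f := fun i j => if j < i then f j i else 0), two_mul]

/-- The alternating binomial convolution of weighted power sums is a double sum of powers of
differences. -/
theorem sum_neg_one_pow_mul_choose_mul_powerSums {R ι : Type*} [CommRing R] [Fintype ι]
    (w z : ι → R) (m : ℕ) :
    ∑ r ∈ Finset.range (m + 1), (-1 : R) ^ (r + 1) * (Nat.choose m r : R) *
        (∑ i, w i * z i ^ r) * (∑ j, w j * z j ^ (m - r)) =
      -∑ i, ∑ j, w i * w j * (z j - z i) ^ m := by
  have hpow : ∀ i j, w i * w j * (z j - z i) ^ m = ∑ r ∈ Finset.range (m + 1),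
      (-1 : R) ^ r * (Nat.choose m r : R) * ((w i * z i ^ r) * (w j * z j ^ (m - r))) := by
    intro i j
    rw [sub_eq_neg_add, add_pow, Finset.mul_sum]
    refine Finset.sum_congr rfl fun r _ => ?_
    rw [neg_pow]
    ring
  simp_rw [hpow]
  rw [Finset.sum_congr rfl fun i _ => Finset.sum_comm, Finset.sum_comm, ← Finset.sum_neg_distrib]
  refine Finset.sum_congr rfl fun r _ => ?_
  simp_rw [← Finset.mul_sum, ← Finset.sum_mul]
  ring

/-- For a commutative ring `R`, `n, k ≥ 1`, and `λᵢ, zᵢ ∈ R` with `∑ λᵢ = 0`: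
`∑_{r=0}^{2k} (-1)^{r+1} C(2k,r) (∑ᵢ λᵢ zᵢ^r)(∑ⱼ λⱼ zⱼ^{2k-r})
  = -2 ∑_{i<j} λᵢ λⱼ (zᵢ - zⱼ)^{2k}`. -/
theorem binomial_lattice_identity (R : Type*) [CommRing R] (n : ℕ) (hn : 1 ≤ n)
    (k : ℕ) (hk : 1 ≤ k) (lam z : Fin n → R) (hlam : ∑ i, lam i = 0) :
    ∑ r ∈ Finset.range (2 * k + 1),
      (-1 : R) ^ (r + 1) * (Nat.choose (2 * k) r : R) *
        (∑ i, lam i * z i ^ r) * (∑ j, lam j * z j ^ (2 * k - r)) =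
    -2 * ∑ i : Fin n, ∑ j ∈ Finset.univ.filter (fun j => i < j),
        lam i * lam j * (z i - z j) ^ (2 * k) := by
  have hsymm : ∀ i j, lam i * lam j * (z j - z i) ^ (2 * k) =
      lam i * lam j * (z i - z j) ^ (2 * k) := fun i j => by
    rw [← neg_sub (z i), (even_two_mul k).neg_pow]
  rw [sum_neg_one_pow_mul_choose_mul_powerSums]
  simp_rw [hsymm]
  rw [sum_sum_eq_two_mul_sum_lt, neg_mul]
  · intro i j
    rw [mul_comm (lam i), ← hsymm j i]
  · intro i
    rw [sub_self, zero_pow (by lia), mul_zero]
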